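/- Let B be an aperiodic Bratteli diagram of finite rank d, and let P be the uniform product probability measure on the space O_B of orders on B. Then there exists j ∈ {1, …, d} such that P-almost every order on B has exactly j maximal infinite paths and exactly j minimal infinite paths. -/

import Mathlib

open MeasureTheory

/-- A Bratteli diagram. -/
structure BratteliDiagram where
  V : ℕ → Type
  E : ℕ → Type
  fintypeV : ∀ n, Fintype (V n)
  fintypeE : ∀ n, Fintype (E n)
  nonemptyV : ∀ n, Nonempty (V n)
  nonemptyE : ∀ n, Nonempty (E n)
  root_subsingleton : ∀ v w : V 0, v = w
  src : ∀ n, E n → V n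
  rng : ∀ n, E n → V (n + 1)
  src_surj : ∀ n, Function.Surjective (src n)
  rng_surj : ∀ n, Function.Surjective (rng n)

attribute [instance] BratteliDiagram.fintypeV BratteliDiagram.fintypeE
  BratteliDiagram.nonemptyV BratteliDiagram.nonemptyE

namespace BratteliDiagram

variable (B : BratteliDiagram)

instance (n : ℕ) : TopologicalSpace (B.E n) := ⊥

/-- The path space `X_B` of a Bratteli diagram. -/
def PathSpace : Type :=
  { x : ∀ n, B.E n // ∀ n, B.rng n (x n) = B.src (n + 1) (x (n + 1)) }

instance : TopologicalSpace B.PathSpace := by unfold PathSpace; infer_instance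

noncomputable instance : MeasurableSpace B.PathSpace := borel _

/-- The vertex at level `n` through which a path passes. -/
def endVtx (n : ℕ) (x : B.PathSpace) : B.V n := B.src n (x.1 n)

/-- The cylinder set of paths agreeing with `x` on the first `n` edges. -/
def cyl (n : ℕ) (x : B.PathSpace) : Set B.PathSpace := { y | ∀ i < n, y.1 i = x.1 i }

/-- Tail equivalence of paths. -/
def tailEq (x y : B.PathSpace) : Prop := ∃ N, ∀ n, N ≤ n → x.1 n = y.1 n

/-- The tail equivalence relation is aperiodic: all classes are infinite. -/
def TailAperiodic : Prop := ∀ x : B.PathSpace, { y | B.tailEq x y }.Infinite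

/-- A measure is invariant for the tail equivalence relation if any two
cylinder sets ending at the same vertex have equal measure. -/
def TailInvariant (μ : Measure B.PathSpace) : Prop :=
  ∀ (n : ℕ) (x y : B.PathSpace), B.endVtx n x = B.endVtx n y →
    μ (B.cyl n x) = μ (B.cyl n y)

/-- Ergodicity with respect to the tail equivalence relation. -/
def TailErgodic (μ : Measure B.PathSpace) : Prop :=
  ∀ S : Set B.PathSpace, MeasurableSet S →
    (∀ x y, B.tailEq x y → (x ∈ S ↔ y ∈ S)) → μ S = 0 ∨ μ Sᶜ = 0

/-- The type of finite paths from the root vertex to `v`. -/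
def FinPathTo : ∀ n, B.V n → Type
  | 0, _ => PUnit
  | n + 1, v => Σ e : { e : B.E n // B.rng n e = v }, FinPathTo n (B.src n e.1)

/-- The height `h_v^{(n)}`: the number of finite paths from the root to `v`. -/
noncomputable def height (n : ℕ) (v : B.V n) : ℕ := Nat.card (B.FinPathTo n v)

/-- The number of edges from `w ∈ V_n` to `v ∈ V_{n+1}`; the entry `f^{(n)}_{v,w}`
of the incidence matrix `F_n`. -/
noncomputable def edgeCount (n : ℕ) (v : B.V (n + 1)) (w : B.V n) : ℕ :=
  Nat.card { e : B.E n // B.rng n e = v ∧ B.src n e = w }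

/-- The incidence matrix `F_n`, as a real matrix. -/
noncomputable def incMat (n : ℕ) : Matrix (B.V (n + 1)) (B.V n) ℝ :=
  fun v w => (B.edgeCount n v w : ℝ)

end BratteliDiagram

namespace BratteliDiagram

variable (B : BratteliDiagram)

/-- The index type for the vertices of `V \ V_0`. -/
def VtxIdx : Type := Σ n : ℕ, B.V (n + 1)

/-- The set `r^{-1}(v)` of edges with range `v`. -/
def EdgesTo (i : B.VtxIdx) : Type := { e : B.E i.1 // B.rng i.1 e = i.2 }

/-- A linear order on `r^{-1}(v)`, encoded as an enumeration of `r^{-1}(v)`. -/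
abbrev OrdAt (i : B.VtxIdx) : Type := B.EdgesTo i ≃ Fin (Nat.card (B.EdgesTo i))

instance (i : B.VtxIdx) : MeasurableSpace (B.OrdAt i) := ⊤

/-- The space `O_B = ∏_v P_v` of all orders on the Bratteli diagram `B`. -/
def OrderSpace : Type := ∀ i : B.VtxIdx, B.OrdAt i

instance : MeasurableSpace B.OrderSpace := by unfold OrderSpace; infer_instance

/-- A path is maximal for the order `ω` if each of its edges is maximal in
`r^{-1}(r(e))`. -/
def IsMaxPathOrd (ω : B.OrderSpace) (x : B.PathSpace) : Prop :=
  ∀ (n : ℕ) (e' : B.EdgesTo ⟨n, B.rng n (x.1 n)⟩),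
    ω ⟨n, B.rng n (x.1 n)⟩ e' ≤ ω ⟨n, B.rng n (x.1 n)⟩ ⟨x.1 n, rfl⟩

/-- A path is minimal for the order `ω` if each of its edges is minimal in
`r^{-1}(r(e))`. -/
def IsMinPathOrd (ω : B.OrderSpace) (x : B.PathSpace) : Prop :=
  ∀ (n : ℕ) (e' : B.EdgesTo ⟨n, B.rng n (x.1 n)⟩),
    ω ⟨n, B.rng n (x.1 n)⟩ ⟨x.1 n, rfl⟩ ≤ ω ⟨n, B.rng n (x.1 n)⟩ e'

/-- `P` is the uniform product probability measure on the order space `O_B`. -/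
def IsUniformOrderMeasure (P : Measure B.OrderSpace) : Prop :=
  IsProbabilityMeasure P ∧
    ∀ (s : Finset B.VtxIdx) (ω₀ : B.OrderSpace),
      P { ω : B.OrderSpace | ∀ i ∈ s, ω i = ω₀ i } =
        ∏ i ∈ s, (Nat.card (B.OrdAt i) : ENNReal)⁻¹

end BratteliDiagram

section InverseSystem

open Filter

/-- The threads of the inverse system given by the bonding maps `p`. -/
def threads {V : ℕ → Type} (p : ∀ n, V (n + 1) → V n) : Set (∀ n, V n) :=
  { x | ∀ n, p n (x (n + 1)) = x n }

/-- The elements of level `n` having a descendant `k` levels higher. -/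
def survivors {V : ℕ → Type} (p : ∀ n, V (n + 1) → V n) : ∀ _ n : ℕ, Set (V n)
  | 0, _ => Set.univ
  | k + 1, n => p n '' survivors p k (n + 1)

variable {V : ℕ → Type} (p : ∀ n, V (n + 1) → V n)

theorem survivors_succ_subset (k n : ℕ) : survivors p (k + 1) n ⊆ survivors p k n := by
  induction k generalizing n with
  | zero => exact Set.subset_univ _
  | succ k ih => exact Set.image_mono (ih (n + 1))

theorem survivors_antitone (n : ℕ) : Antitone fun k => survivors p k n :=
  antitone_nat_of_succ_le fun k => survivors_succ_subset p k n

theorem survivors_nonempty [∀ n, Nonempty (V n)] (k n : ℕ) : (survivors p k n).Nonempty := by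
  induction k generalizing n with
  | zero => exact Set.univ_nonempty
  | succ k ih => exact (ih (n + 1)).image _

theorem mem_survivors_of_mem_threads {x : ∀ n, V n} (hx : x ∈ threads p) (k n : ℕ) :
    x n ∈ survivors p k n := by
  induction k generalizing n with
  | zero => exact Set.mem_univ _
  | succ k ih => exact ⟨x (n + 1), ih (n + 1), hx n⟩

theorem survivors_shift (k n : ℕ) :
    survivors (V := fun m => V (m + 1)) (fun m => p (m + 1)) k n = survivors p k (n + 1) := by
  induction k generalizing n with
  | zero => rfl
  | succ k ih => simp only [survivors, ih]

theorem exists_survivor_above [∀ n, Finite (V n)] {n : ℕ} {v : V n}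
    (hv : ∀ k, v ∈ survivors p k n) :
    ∃ w, p n w = v ∧ ∀ k, w ∈ survivors p k (n + 1) := by
  by_contra! h
  have h2 : ∀ w, ∀ᶠ k in atTop, p n w = v → w ∉ survivors p k (n + 1) := fun w => by
    by_cases hw : p n w = v
    · obtain ⟨k, hk⟩ := h w hw
      filter_upwards [eventually_ge_atTop k] with l hl _ hwl
      exact hk (survivors_antitone p (n + 1) hl hwl)
    · exact Eventually.of_forall fun _ h => absurd h hw
  obtain ⟨k, hk⟩ := (eventually_all.2 h2).exists
  obtain ⟨w, hw, hwv⟩ := hv (k + 1)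
  exact hk w hwv hw

theorem exists_thread_of_survives [∀ n, Finite (V n)] {n : ℕ} {v : V n}
    (hv : ∀ k, v ∈ survivors p k n) : ∃ x ∈ threads p, x n = v := by
  induction n generalizing V with
  | zero =>
    choose f hf using fun (n : ℕ) (v : { v : V n // ∀ k, v ∈ survivors p k n }) =>
      exists_survivor_above p v.2
    let x : ∀ n, { v : V n // ∀ k, v ∈ survivors p k n } := fun n =>
      Nat.rec ⟨v, hv⟩ (fun n v => ⟨f n v, (hf n v).2⟩) n
    exact ⟨fun n => (x n).1, fun n => (hf n (x n)).1, rfl⟩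
  | succ n ih =>
    obtain ⟨x, hx, hxv⟩ := ih (V := fun m => V (m + 1)) (fun m => p (m + 1)) (v := v)
      fun k => by rw [survivors_shift]; exact hv k
    refine ⟨fun m => Nat.casesOn m (p 0 (x 0)) x, fun m => ?_, hxv⟩
    cases m with
    | zero => rfl
    | succ m => exact hx m

theorem thread_eq_of_le {x y : ∀ n, V n} (hx : x ∈ threads p) (hy : y ∈ threads p) {m n : ℕ}
    (hmn : m ≤ n) (h : x n = y n) : x m = y m := by
  induction n, hmn using Nat.le_induction with
  | base => exact h
  | succ n _ ih => exact ih (by rw [← hx n, ← hy n, h])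

theorem eventually_le_encard_survivors {j : ℕ} (h : (j : ℕ∞) ≤ (threads p).encard) :
    ∀ᶠ n in atTop, ∀ k, (j : ℕ∞) ≤ (survivors p k n).encard := by
  obtain ⟨t, hts, htj⟩ := Set.exists_subset_encard_eq h
  have htf : t.Finite := Set.finite_of_encard_eq_coe htj
  have hsep : ∀ᶠ n in atTop, ∀ x ∈ t, ∀ y ∈ t, x n = y n → x = y := by
    refine (eventually_all_finite htf).2 fun x hx => (eventually_all_finite htf).2 fun y hy => ?_
    by_cases hxy : x = y
    · exact Eventually.of_forall fun _ _ => hxy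
    · obtain ⟨m, hm⟩ := Function.ne_iff.1 hxy
      filter_upwards [eventually_ge_atTop m] with n hn h
      exact absurd (thread_eq_of_le p (hts hx) (hts hy) hn h) hm
  filter_upwards [hsep] with n hn k
  have hinj : Set.InjOn (fun x : ∀ n, V n => x n) t := fun x hx y hy => hn x hx y hy
  rw [← htj, ← hinj.encard_image]
  refine Set.encard_le_encard ?_
  rintro _ ⟨x, hx, rfl⟩
  exact mem_survivors_of_mem_threads p (hts hx) k n

theorem le_encard_threads [∀ n, Finite (V n)] {j n : ℕ}
    (h : ∀ k, (j : ℕ∞) ≤ (survivors p k n).encard) : (j : ℕ∞) ≤ (threads p).encard := by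
  have hst : ∀ v : V n, ∀ᶠ k in atTop, v ∈ survivors p k n → ∀ l, v ∈ survivors p l n := fun v => by
    by_cases hv : ∀ l, v ∈ survivors p l n
    · exact Eventually.of_forall fun _ _ => hv
    · push Not at hv
      obtain ⟨l, hl⟩ := hv
      filter_upwards [eventually_ge_atTop l] with k hk hvk
      exact absurd (survivors_antitone p n hk hvk) hl
  obtain ⟨k, hk⟩ := (eventually_all.2 hst).exists
  refine (h k).trans (le_trans (Set.encard_le_encard ?_)
    (Set.encard_image_le (fun x : ∀ n, V n => x n) (threads p)))
  exact fun v hv => exists_thread_of_survives p (hk v hv)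

theorem le_encard_threads_iff [∀ n, Finite (V n)] (j N : ℕ) :
    (j : ℕ∞) ≤ (threads p).encard ↔
      ∃ n, N ≤ n ∧ ∀ k, (j : ℕ∞) ≤ (survivors p k n).encard := by
  constructor
  · intro h
    obtain ⟨n, hn, hNn⟩ :=
      ((eventually_le_encard_survivors p h).and (eventually_ge_atTop N)).exists
    exact ⟨n, hNn, hn⟩
  · rintro ⟨n, -, h⟩
    exact le_encard_threads p h

theorem one_le_encard_threads [∀ n, Finite (V n)] [∀ n, Nonempty (V n)] :
    1 ≤ (threads p).encard := by
  have h := le_encard_threads p (j := 1) (n := 0) fun k => by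
    simpa [Set.one_le_encard_iff_nonempty] using survivors_nonempty p k 0
  simpa using h

theorem encard_threads_le [∀ n, Finite (V n)] {d : ℕ}
    (h : ∃ᶠ n in atTop, Nat.card (V n) = d) : (threads p).encard ≤ d := by
  by_contra! hlt
  have h1 : ((d + 1 : ℕ) : ℕ∞) ≤ (threads p).encard := by
    push_cast
    exact Order.add_one_le_of_lt hlt
  obtain ⟨n, hn, hs⟩ := (h.and_eventually (eventually_le_encard_survivors p h1)).exists
  have h2 := hs 0
  rw [survivors, Set.encard_univ, ENat.card_eq_coe_natCard, hn] at h2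
  exact absurd (Nat.cast_le.1 h2) (by omega)

/-- If the bonding maps of an inverse system depend measurably on a parameter, then so does
the set of survivors. -/
theorem measurableSet_le_encard_survivors [∀ n, Finite (V n)] {Ω : Type*} {m : MeasurableSpace Ω}
    (q : Ω → ∀ n, V (n + 1) → V n) {N : ℕ}
    (hq : ∀ n, N ≤ n → ∀ w v, MeasurableSet { ω | q ω n w = v }) {n : ℕ} (hn : N ≤ n) (j k : ℕ) :
    MeasurableSet { ω | (j : ℕ∞) ≤ (survivors (q ω) k n).encard } := by
  have hmem : ∀ k n, N ≤ n → ∀ v, MeasurableSet { ω | v ∈ survivors (q ω) k n } := by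
    intro k
    induction k with
    | zero => exact fun n _ v => by simp [survivors]
    | succ k ih =>
      intro n hn v
      have : { ω | v ∈ survivors (q ω) (k + 1) n } =
          ⋃ w, { ω | w ∈ survivors (q ω) k (n + 1) } ∩ { ω | q ω n w = v } := by
        ext ω
        simp [survivors]
      rw [this]
      exact MeasurableSet.iUnion fun w => (ih (n + 1) (by omega) w).inter (hq n hn w v)
  have : { ω | (j : ℕ∞) ≤ (survivors (q ω) k n).encard } =
      ⋃ t : { t : Set (V n) // (j : ℕ∞) ≤ t.encard },
        ⋂ v : t.1, { ω | v.1 ∈ survivors (q ω) k n } := by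
    ext ω
    simp only [Set.mem_ofPred_eq, Set.mem_iUnion, Set.mem_iInter]
    exact ⟨fun h => ⟨⟨_, h⟩, fun v => v.2⟩,
      fun ⟨t, ht⟩ => t.2.trans (Set.encard_le_encard fun v hv => ht ⟨v, hv⟩)⟩
  rw [this]
  exact MeasurableSet.iUnion fun t => MeasurableSet.iInter fun v => hmem k n hn v

theorem measurableSet_le_encard_threads [∀ n, Finite (V n)] {Ω : Type*} {m : MeasurableSpace Ω}
    (q : Ω → ∀ n, V (n + 1) → V n) (N : ℕ)
    (hq : ∀ n, N ≤ n → ∀ w v, MeasurableSet { ω | q ω n w = v }) (j : ℕ) :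
    MeasurableSet { ω | (j : ℕ∞) ≤ (threads (q ω)).encard } := by
  simp only [fun ω => le_encard_threads_iff (q ω) j N, Set.ofPred_exists, Set.ofPred_and,
    Set.ofPred_forall]
  exact MeasurableSet.iUnion fun n => by
    by_cases hn : N ≤ n
    · exact (MeasurableSet.const _).inter (MeasurableSet.iInter fun k =>
        measurableSet_le_encard_survivors q hq hn j k)
    · simp [hn]

end InverseSystem

section ProductMeasure

open ProbabilityTheory

/-- A measure on a product of finite discrete spaces is the product measure as soon as it gives
the right mass to the cylinders fixing finitely many coordinates. -/
theorem eq_infinitePi_of_cylinder {ι : Type*} {X : ι → Type*} [∀ i, Finite (X i)]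
    [∀ i, Nonempty (X i)] [∀ i, MeasurableSpace (X i)] [∀ i, DiscreteMeasurableSpace (X i)]
    (u : ∀ i, Measure (X i)) [∀ i, IsProbabilityMeasure (u i)] (P : Measure (∀ i, X i))
    (h : ∀ (s : Finset ι) (ω₀ : ∀ i, X i), P { ω | ∀ i ∈ s, ω i = ω₀ i } = ∏ i ∈ s, u i {ω₀ i}) :
    P = Measure.infinitePi u := by
  classical
  refine IsProjectiveLimit.unique (P := fun I : Finset ι => Measure.pi fun i : I => u i)
    (fun s => ?_) (Measure.isProjectiveLimit_infinitePi u)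
  refine Measure.ext_of_singleton fun a => ?_
  let ω₀ : ∀ i, X i := fun i => if hi : i ∈ s then a ⟨i, hi⟩ else Classical.arbitrary _
  have hω₀ : ∀ i : s, ω₀ i = a i := fun i => by simp [ω₀]
  rw [Measure.map_apply (by fun_prop) (measurableSet_singleton a), Measure.pi_singleton]
  have : s.restrict ⁻¹' {a} = { ω : ∀ i, X i | ∀ i ∈ s, ω i = ω₀ i } := by
    ext ω
    simp only [Set.mem_preimage, Set.mem_singleton_iff, funext_iff, Set.mem_ofPred_eq,
      Subtype.forall]
    exact forall₂_congr fun i hi => by rw [hω₀ ⟨i, hi⟩]; rfl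
  rw [this, h, ← Finset.prod_coe_sort]
  simp only [hω₀]

/-- Kolmogorov's zero-one law for product measures, for events that do not depend on any
given finite set of coordinates. -/
theorem infinitePi_ae_mem_or_ae_notMem {ι : Type*} {X : ι → Type*} [∀ i, MeasurableSpace (X i)]
    (u : ∀ i, Measure (X i)) [∀ i, IsProbabilityMeasure (u i)] {A : Set (∀ i, X i)}
    (hA : ∀ T : Set ι, Tᶜ.Finite →
      MeasurableSet[⨆ i ∈ T, MeasurableSpace.comap (fun ω : ∀ i, X i => ω i) inferInstance] A) :
    (∀ᵐ ω ∂Measure.infinitePi u, ω ∈ A) ∨ ∀ᵐ ω ∂Measure.infinitePi u, ω ∉ A := by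
  have hAm : MeasurableSet A :=
    iSup₂_le (fun i _ => (measurable_pi_apply i).comap_le) _ (hA Set.univ (by simp))
  rw [← measure_eq_zero_iff_ae_notMem, or_comm]
  change _ ∨ A ∈ ae _
  rw [mem_ae_iff_prob_eq_one hAm]
  refine measure_zero_or_one_of_measurableSet_limsup (f := Filter.cofinite)
    (s := fun i => MeasurableSpace.comap (fun ω : ∀ i, X i => ω i) inferInstance)
    (p := Set.Finite) (ns := fun s : Finset ι => (s : Set ι))
    (fun i => (measurable_pi_apply i).comap_le)
    (iIndepFun_infinitePi (X := fun _ x => x) fun _ => measurable_id).iIndep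
    (fun t ht => by simpa using ht) ?_
    (fun s => s.finite_toSet) (fun i => ⟨{i}, by simp⟩) ?_
  · exact Monotone.directed_le fun s t hst => Finset.coe_subset.2 hst
  · rw [Filter.limsup_eq_iInf_iSup]
    simp only [MeasurableSpace.measurableSet_iInf]
    exact fun T hT => hA T hT

end ProductMeasure

namespace BratteliDiagram

open ProbabilityTheory

variable (B : BratteliDiagram)

instance (i : B.VtxIdx) : Finite (B.EdgesTo i) := by unfold EdgesTo; infer_instance

instance (i : B.VtxIdx) : Nonempty (B.EdgesTo i) :=
  let ⟨e, he⟩ := B.rng_surj i.1 i.2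
  ⟨⟨e, he⟩⟩

instance (i : B.VtxIdx) : Nonempty (B.OrdAt i) := ⟨Finite.equivFin _⟩

instance (i : B.VtxIdx) : DiscreteMeasurableSpace (B.OrdAt i) := ⟨fun _ => trivial⟩

variable {B}

/-- The largest edge of `r⁻¹(v)` for a given order. -/
noncomputable def maxEdge {i : B.VtxIdx} (o : B.OrdAt i) : B.EdgesTo i :=
  (Finite.exists_max o).choose

theorem le_maxEdge {i : B.VtxIdx} (o : B.OrdAt i) (e : B.EdgesTo i) : o e ≤ o (maxEdge o) :=
  (Finite.exists_max o).choose_spec e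

theorem forall_le_iff_eq_maxEdge {i : B.VtxIdx} (o : B.OrdAt i) (e : B.EdgesTo i) :
    (∀ e', o e' ≤ o e) ↔ maxEdge o = e :=
  ⟨fun h => o.injective (le_antisymm (h _) (le_maxEdge o e)), fun h => h ▸ le_maxEdge o⟩

/-- The source of the largest edge with range `v`. -/
noncomputable def maxParent (ω : B.OrderSpace) (n : ℕ) (v : B.V (n + 1)) : B.V n :=
  B.src n (maxEdge (ω ⟨n, v⟩)).1

theorem isMaxPathOrd_iff (ω : B.OrderSpace) (x : B.PathSpace) :
    B.IsMaxPathOrd ω x ↔ ∀ n, (maxEdge (ω ⟨n, B.rng n (x.1 n)⟩)).1 = x.1 n :=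
  forall_congr' fun n => (forall_le_iff_eq_maxEdge (i := ⟨n, B.rng n (x.1 n)⟩) _ _).trans
    Subtype.ext_iff

/-- Maximal paths correspond to threads of the inverse system of `maxParent` maps. -/
theorem encard_maxPaths (ω : B.OrderSpace) :
    { x | B.IsMaxPathOrd ω x }.encard = (threads (maxParent ω)).encard := by
  have hinj : Set.InjOn (fun (x : B.PathSpace) n => B.endVtx n x) { x | B.IsMaxPathOrd ω x } := by
    intro x hx y hy hxy
    refine Subtype.ext (funext fun n => ?_)
    have h : B.rng n (x.1 n) = B.rng n (y.1 n) := by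
      rw [x.2 n, y.2 n]
      exact congrFun hxy (n + 1)
    rw [← (isMaxPathOrd_iff ω x).1 hx n, ← (isMaxPathOrd_iff ω y).1 hy n, h]
  rw [← hinj.encard_image]
  congr 1
  ext v
  constructor
  · rintro ⟨x, hx, rfl⟩ n
    have h := (isMaxPathOrd_iff ω x).1 hx n
    rw [x.2 n] at h
    exact congrArg (B.src n) h
  · intro hv
    have hr : ∀ n, B.rng n (maxEdge (ω ⟨n, v (n + 1)⟩)).1 = v (n + 1) := fun n =>
      (maxEdge (ω ⟨n, v (n + 1)⟩)).2
    refine ⟨⟨fun n => (maxEdge (ω ⟨n, v (n + 1)⟩)).1, fun n => ?_⟩, ?_, funext hv⟩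
    · rw [hr]
      exact (hv (n + 1)).symm
    · refine (isMaxPathOrd_iff ω _).2 fun n => ?_
      exact congrArg (β := B.E n) (fun w : B.V (n + 1) => (maxEdge (ω ⟨n, w⟩)).1) (hr n)

/-- The order obtained by reversing all the orders on the sets `r⁻¹(v)`. -/
noncomputable def reverseOrder (ω : B.OrderSpace) : B.OrderSpace := fun i => (ω i).trans Fin.revPerm

theorem reverseOrder_reverseOrder (ω : B.OrderSpace) : reverseOrder (reverseOrder ω) = ω :=
  funext fun i => Equiv.ext fun e => Fin.rev_rev (ω i e)

theorem isMinPathOrd_iff (ω : B.OrderSpace) (x : B.PathSpace) :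
    B.IsMinPathOrd ω x ↔ B.IsMaxPathOrd (reverseOrder ω) x :=
  forall₂_congr fun _ _ => Fin.rev_le_rev.symm

theorem measurable_reverseOrder : Measurable (reverseOrder : B.OrderSpace → B.OrderSpace) := by
  refine measurable_pi_iff.2 fun i => ?_
  exact (Measurable.of_discrete (f := fun o : B.OrdAt i => o.trans Fin.revPerm)).comp
    (measurable_pi_apply i)

theorem IsUniformOrderMeasure.eq_infinitePi {P : Measure B.OrderSpace}
    (hP : B.IsUniformOrderMeasure P) :
    P = (Measure.infinitePi (fun i => uniformOn (Set.univ : Set (B.OrdAt i))) :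
      Measure (∀ i, B.OrdAt i)) := by
  refine eq_infinitePi_of_cylinder (X := fun i => B.OrdAt i) _ P fun s ω₀ => ?_
  refine (hP.2 s ω₀).trans (Finset.prod_congr rfl fun i _ => ?_)
  have := Fintype.ofFinite (B.OrdAt i)
  rw [uniformOn_univ, Measure.count_singleton, Nat.card_eq_fintype_card, one_div]

theorem IsUniformOrderMeasure.map_reverseOrder {P : Measure B.OrderSpace}
    (hP : B.IsUniformOrderMeasure P) : P.map reverseOrder = P := by
  have := hP.1
  suffices B.IsUniformOrderMeasure (P.map reverseOrder) from
    this.eq_infinitePi.trans hP.eq_infinitePi.symm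
  refine ⟨Measure.isProbabilityMeasure_map measurable_reverseOrder.aemeasurable,
    fun s ω₀ => ?_⟩
  rw [← hP.2 s (reverseOrder ω₀), Measure.map_apply measurable_reverseOrder]
  · congr 1
    ext ω
    refine forall₂_congr fun i _ => ?_
    constructor
    · rintro h
      rw [← reverseOrder_reverseOrder ω]
      exact congrArg (fun o : B.OrdAt i => o.trans Fin.revPerm) h
    · intro h
      rw [← reverseOrder_reverseOrder ω₀]
      exact congrArg (fun o : B.OrdAt i => o.trans Fin.revPerm) h
  · have : { ω : B.OrderSpace | ∀ i ∈ s, ω i = ω₀ i } =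
        ⋂ i ∈ s, (fun ω : B.OrderSpace => ω i) ⁻¹' {ω₀ i} := by
      ext ω
      simp
    rw [this]
    exact Finset.measurableSet_biInter s fun i _ =>
      measurable_pi_apply (X := fun i => B.OrdAt i) i (measurableSet_singleton _)

theorem IsUniformOrderMeasure.ae_le_or_ae_lt_encard_maxPaths {P : Measure B.OrderSpace}
    (hP : B.IsUniformOrderMeasure P) (j : ℕ) :
    (∀ᵐ ω ∂P, (j : ℕ∞) ≤ { x | B.IsMaxPathOrd ω x }.encard) ∨
      ∀ᵐ ω ∂P, { x | B.IsMaxPathOrd ω x }.encard < j := by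
  simp only [encard_maxPaths, ← not_le]
  rw [hP.eq_infinitePi]
  refine infinitePi_ae_mem_or_ae_notMem (X := fun i => B.OrdAt i) _
    (A := { ω | (j : ℕ∞) ≤ (threads (maxParent ω)).encard }) fun T hT => ?_
  obtain ⟨N, hN⟩ := (hT.image Sigma.fst).bddAbove
  refine measurableSet_le_encard_threads
    (m := ⨆ i ∈ T, MeasurableSpace.comap (fun ω : ∀ i, B.OrdAt i => ω i) inferInstance)
    (fun ω => maxParent ω) (N + 1) (fun n hn w v => ?_) j
  have hT : (⟨n, w⟩ : B.VtxIdx) ∈ T := by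
    by_contra h
    exact absurd (hN ⟨_, h, rfl⟩) (by simpa using hn)
  refine le_iSup₂ (f := fun (i : B.VtxIdx) (_ : i ∈ T) =>
    MeasurableSpace.comap (fun ω : ∀ i, B.OrdAt i => ω i) inferInstance) ⟨n, w⟩ hT _ ?_
  exact ⟨{ o | B.src n (maxEdge o).1 = v }, trivial, rfl⟩

theorem IsUniformOrderMeasure.exists_encard_maxPaths_eq {P : Measure B.OrderSpace}
    (hP : B.IsUniformOrderMeasure P) {d : ℕ}
    (hd : ∃ᶠ n in Filter.atTop, Nat.card (B.V n) = d) :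
    ∃ j : ℕ, 1 ≤ j ∧ j ≤ d ∧ ∀ᵐ ω ∂P, { x | B.IsMaxPathOrd ω x }.encard = j := by
  classical
  have := hP.1
  let A : ℕ → Prop := fun j => ∀ᵐ ω ∂P, (j : ℕ∞) ≤ { x | B.IsMaxPathOrd ω x }.encard
  have hle : ∀ ω : B.OrderSpace, { x | B.IsMaxPathOrd ω x }.encard ≤ d := fun ω => by
    rw [encard_maxPaths]
    exact encard_threads_le _ hd
  have hA1 : A 1 := Filter.Eventually.of_forall fun ω => by
    rw [encard_maxPaths]
    exact_mod_cast one_le_encard_threads (maxParent ω)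
  have hAd : ∀ j, A j → j ≤ d := fun j hj => by
    obtain ⟨ω, hω⟩ := hj.exists
    exact_mod_cast hω.trans (hle ω)
  have hg : A (Nat.findGreatest A d) := Nat.findGreatest_spec (hAd 1 hA1) hA1
  refine ⟨Nat.findGreatest A d, Nat.le_findGreatest (hAd 1 hA1) hA1, Nat.findGreatest_le d, ?_⟩
  have hlt := (hP.ae_le_or_ae_lt_encard_maxPaths (Nat.findGreatest A d + 1)).resolve_left
    fun h => Nat.findGreatest_is_greatest (Nat.lt_succ_self _) (hAd _ h) h
  filter_upwards [hg, hlt] with ω h1 h2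
  refine le_antisymm (not_lt.1 fun h => not_le.2 h2 ?_) h1
  exact_mod_cast Order.add_one_le_of_lt h

end BratteliDiagram

/-- **Bezuglyi–Kwiatkowski–Yassawi.** For an aperiodic Bratteli diagram of finite rank
`d`, there is `j ∈ {1, …, d}` such that, with respect to the uniform product measure on
the space of orders, almost every order has exactly `j` maximal and exactly `j` minimal
infinite paths. -/
theorem random_orders_finite_rank_dichotomy
    (B : BratteliDiagram)
    (hCantor : ∀ x : B.PathSpace, ¬IsOpen ({x} : Set B.PathSpace))
    (haper : B.TailAperiodic)
    (d : ℕ) (hd : 1 ≤ d)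
    (hfr : ∃ k : ℕ, ∀ n : ℕ, Nat.card (B.V n) ≤ k)
    (hrank : { n : ℕ | 1 ≤ n ∧ Nat.card (B.V n) = d }.Infinite)
    (hleast : ∀ d' : ℕ, d' < d → ¬({ n : ℕ | 1 ≤ n ∧ Nat.card (B.V n) = d' }.Infinite))
    (P : Measure B.OrderSpace) (hP : B.IsUniformOrderMeasure P) :
    ∃ j : ℕ, 1 ≤ j ∧ j ≤ d ∧
      P { ω : B.OrderSpace |
        ({ x : B.PathSpace | B.IsMaxPathOrd ω x }).Finite ∧
        ({ x : B.PathSpace | B.IsMaxPathOrd ω x }).ncard = j ∧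
        ({ x : B.PathSpace | B.IsMinPathOrd ω x }).Finite ∧
        ({ x : B.PathSpace | B.IsMinPathOrd ω x }).ncard = j } = 1 := by
  have hfreq : ∃ᶠ n in Filter.atTop, Nat.card (B.V n) = d :=
    Nat.frequently_atTop_iff_infinite.2 (hrank.mono fun n hn => hn.2)
  obtain ⟨j, hj1, hjd, hj⟩ := hP.exists_encard_maxPaths_eq hfreq
  have hj' : ∀ᵐ ω ∂P, { x | B.IsMaxPathOrd (BratteliDiagram.reverseOrder ω) x }.encard = j := by
    rw [← hP.map_reverseOrder] at hj
    exact ae_of_ae_map BratteliDiagram.measurable_reverseOrder.aemeasurable hj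
  have := hP.1
  have hcard : ∀ {s : Set B.PathSpace}, s.encard = j → s.Finite ∧ s.ncard = j := fun h =>
    ⟨Set.finite_of_encard_eq_coe h, by rw [Set.ncard, h, ENat.toNat_natCast]⟩
  refine ⟨j, hj1, hjd, ?_⟩
  refine (measure_congr (Filter.eventuallyEq_univ.2 ?_)).trans (measure_univ (μ := P))
  filter_upwards [hj, hj'] with ω h1 h2
  simp only [← BratteliDiagram.isMinPathOrd_iff] at h2
  exact ⟨(hcard h1).1, (hcard h1).2, (hcard h2).1, (hcard h2).2⟩
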